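/- Let q be a prime power, let C_b ⊆ F_q^n be a linear code with A(W) = #{y ∈ C_b : wt(y) = W}, and let d ≥ 1 be an integer. If Σ_{W=1}^{d} A(W)² / ((q−1)^W · binom(n,W)) < 1, then there exist a permutation pair (π1, π2) of {1,…,n} and vectors c1, c2 ∈ (F_q∖{0})^n such that the code C(π1,c1,π2,c2) = {x ∈ F_q^n : φ_{π1,c1}(x) ∈ C_b and φ_{π2,c2}(x) ∈ C_b} contains no nonzero codeword of Hamming weight at most d (i.e. its minimum distance exceeds d, or it is the zero code). -/

import Mathlib

open Finset in
theorem sphere_card_aux (n W : ℕ) (F : Type) [Field F] [Fintype F] [DecidableEq F] :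
    (univ.filter (fun x : Fin n → F => hammingNorm x = W)).card
      = (Fintype.card F - 1) ^ W * n.choose W := by
  classical
  have h1 : ∀ x ∈ univ.filter (fun x : Fin n → F => hammingNorm x = W),
      (univ.filter (fun i => x i ≠ 0)) ∈ powersetCard W (univ : Finset (Fin n)) := by
    intro x hx
    rw [mem_powersetCard]
    exact ⟨subset_univ _, (mem_filter.1 hx).2⟩
  rw [card_eq_sum_card_fiberwise h1]
  have h2 : ∀ s ∈ powersetCard W (univ : Finset (Fin n)),
      ((univ.filter (fun x : Fin n → F => hammingNorm x = W)).filter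
        (fun x => (univ.filter (fun i => x i ≠ 0)) = s)).card = (Fintype.card F - 1) ^ W := by
    intro s hs
    rw [mem_powersetCard] at hs
    have : ((univ.filter (fun x : Fin n → F => hammingNorm x = W)).filter
        (fun x => (univ.filter (fun i => x i ≠ 0)) = s))
        = Fintype.piFinset (fun i => if i ∈ s then (univ : Finset F).erase 0 else {0}) := by
      ext x
      simp only [mem_filter, mem_univ, true_and, Fintype.mem_piFinset]
      constructor
      · rintro ⟨_, rfl⟩ i
        by_cases hi : x i = 0 <;> simp [hi]
      · intro hx
        have hxs : (univ.filter (fun i => x i ≠ 0)) = s := by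
          ext i
          have := hx i
          by_cases hi : i ∈ s <;> simp_all
        refine ⟨?_, hxs⟩
        rw [← hs.2, ← hxs]
        rfl
    rw [this, Fintype.card_piFinset]
    have h3 : ∀ i, (if i ∈ s then (univ : Finset F).erase 0 else {0}).card
        = if i ∈ s then (Fintype.card F - 1) else 1 := by
      intro i
      split_ifs <;> simp [card_erase_of_mem]
    rw [prod_congr rfl (fun i _ => h3 i)]
    rw [prod_ite_mem, univ_inter, prod_const, hs.2]
  rw [sum_congr rfl h2]
  simp [mul_comm]

/-- monomial action -/
def monoAct {n : ℕ} {F : Type} [Field F] (g : Equiv.Perm (Fin n) × (Fin n → Fˣ))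
    (x : Fin n → F) : Fin n → F := fun j => (g.2 j : F) * x (g.1 j)

theorem monoAct_trans_aux {n : ℕ} {F : Type} [Field F] [DecidableEq F] (z z' : Fin n → F)
    (h : hammingNorm z = hammingNorm z') : ∃ g, monoAct g z = z' := by
  classical
  have hc : Fintype.card {j // z' j ≠ 0} = Fintype.card {j // z j ≠ 0} := by
    rw [Fintype.card_subtype, Fintype.card_subtype]
    exact h.symm
  let e := Fintype.equivOfCardEq hc
  let ρ : Equiv.Perm (Fin n) := e.extendSubtype
  have hρ : ∀ j, z' j ≠ 0 → z (ρ j) ≠ 0 := fun j hj => e.extendSubtype_mem j hj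
  have hρ' : ∀ j, z' j = 0 → z (ρ j) = 0 := fun j hj => by
    have := e.extendSubtype_not_mem j (by simpa using hj)
    simpa using this
  refine ⟨(ρ, fun j => if hj : z' j = 0 then 1 else
    Units.mk0 (z' j / z (ρ j)) (div_ne_zero hj (hρ j hj))), ?_⟩
  funext j
  simp only [monoAct]
  by_cases hj : z' j = 0
  · simp [hj, hρ' j hj]
  · have := hρ j hj
    simp [hj]
    field_simp

theorem monoAct_norm {n : ℕ} {F : Type} [Field F] [DecidableEq F]
    (g : Equiv.Perm (Fin n) × (Fin n → Fˣ)) (x : Fin n → F) :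
    hammingNorm (monoAct g x) = hammingNorm x := by
  classical
  unfold hammingNorm
  refine Finset.card_bij (fun j _ => g.1 j) ?_ ?_ ?_
  · intro j hj
    simpa [monoAct] using hj
  · intro a _ b _ hab
    exact g.1.injective hab
  · intro b hb
    exact ⟨g.1.symm b, by simpa [monoAct] using hb, by simp⟩

open Finset in
theorem monoAct_le_aux {n : ℕ} {F : Type} [Field F] [Fintype F] [DecidableEq F]
    (y z z' : Fin n → F) (h : hammingNorm z = hammingNorm z') :
    (univ.filter (fun g => monoAct g y = z)).card
      ≤ (univ.filter (fun g => monoAct g y = z')).card := by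
  classical
  obtain ⟨k, hk⟩ := monoAct_trans_aux z z' h
  refine card_le_card_of_injOn (fun g => (g.1 * k.1, fun j => k.2 j * g.2 (k.1 j))) ?_ ?_
  · intro g hg
    have hg : monoAct g y = z := by simpa using hg
    have : monoAct (g.1 * k.1, fun j => k.2 j * g.2 (k.1 j)) y = z' := by
      rw [← hk, ← hg]
      funext j
      simp [monoAct, mul_assoc]
    simpa using this
  · rintro ⟨a, b⟩ _ ⟨a', b'⟩ _ hab
    simp only [Prod.mk.injEq, mul_left_inj] at hab
    refine Prod.ext hab.1 ?_
    funext j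
    have := congrFun hab.2 (k.1.symm j)
    simpa using this

open Finset in
theorem monoAct_count_aux {n : ℕ} {F : Type} [Field F] [Fintype F] [DecidableEq F]
    (y z : Fin n → F) :
    (univ.filter (fun g => monoAct g y = z)).card
      * ((Fintype.card F - 1) ^ (hammingNorm z) * n.choose (hammingNorm z))
      ≤ Fintype.card (Equiv.Perm (Fin n) × (Fin n → Fˣ)) := by
  classical
  rw [← sphere_card_aux, mul_comm, ← smul_eq_mul, ← sum_const]
  calc _ ≤ ∑ z' ∈ univ.filter (fun x : Fin n → F => hammingNorm x = hammingNorm z),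
        (univ.filter (fun g => monoAct g y = z')).card :=
        sum_le_sum (fun z' hz' => monoAct_le_aux y z z' (mem_filter.1 hz').2.symm)
    _ ≤ ∑ z' : Fin n → F, (univ.filter (fun g => monoAct g y = z')).card :=
        sum_le_sum_of_subset (filter_subset _ _)
    _ = _ := by
        rw [← card_eq_sum_card_fiberwise (fun _ _ => mem_coe.2 (mem_univ _)), card_univ]

/-- Let q be a prime power, let C_b ⊆ F_q^n be a linear code with
A(W) = #{y ∈ C_b : wt(y) = W}, and let d ≥ 1.  If
Σ_{W=1}^{d} A(W)² / ((q−1)^W · binom(n,W)) < 1, then there exist permutations π1, π2 of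
{1,…,n} and vectors c1, c2 ∈ (F_q∖{0})^n such that the code
C(π1,c1,π2,c2) = {x : φ_{π1,c1}(x) ∈ C_b and φ_{π2,c2}(x) ∈ C_b} contains no nonzero
codeword of Hamming weight at most d. -/
theorem statement_13 (q n d : ℕ) (hq : IsPrimePow q) (hd : 1 ≤ d)
    (F : Type) [Field F] [Fintype F] [DecidableEq F] (hF : Fintype.card F = q)
    (Cb : Submodule F (Fin n → F))
    (A : ℕ → ℕ) (hA : ∀ W, A W = Nat.card {y : Fin n → F // y ∈ Cb ∧ hammingNorm y = W})
    (h : ∑ W ∈ Finset.Icc 1 d, (A W : ℚ) ^ 2 / (((q : ℚ) - 1) ^ W * (n.choose W : ℚ)) < 1) :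
    ∃ (π1 π2 : Equiv.Perm (Fin n)) (c1 c2 : Fin n → F),
      (∀ j, c1 j ≠ 0) ∧ (∀ j, c2 j ≠ 0) ∧
      ∀ x : Fin n → F,
        (fun j => c1 j * x (π1 j)) ∈ Cb → (fun j => c2 j * x (π2 j)) ∈ Cb →
        x ≠ 0 → d < hammingNorm x := by
  classical
  let G := Equiv.Perm (Fin n) × (Fin n → Fˣ)
  let S : ℕ → Finset (Fin n → F) := fun W =>
    Finset.univ.filter (fun y => y ∈ Cb ∧ hammingNorm y = W)
  have hS : ∀ W, (S W).card = A W := by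
    intro W
    rw [hA W, Nat.card_eq_fintype_card, Fintype.card_subtype]
  let T : (Fin n → F) → (Fin n → F) → Finset G := fun y z =>
    Finset.univ.filter (fun g => monoAct g y = z)
  let B : Finset G := (Finset.Icc 1 d).biUnion fun W =>
    (S W ×ˢ S W).biUnion fun p => T p.1 p.2
  have hq1 : 1 < q := hq.one_lt
  have hG : (0 : ℚ) < Fintype.card G := by exact_mod_cast Fintype.card_pos
  have hT : ∀ W, ∀ p ∈ S W ×ˢ S W, ((T p.1 p.2).card : ℚ) ≤
      Fintype.card G / (((q : ℚ) - 1) ^ W * (n.choose W : ℚ)) := by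
    intro W p hp
    have hz : hammingNorm p.2 = W := (Finset.mem_filter.1 (Finset.mem_product.1 hp).2).2.2
    have hWn : W ≤ n := by
      rw [← hz]
      simpa using hammingNorm_le_card_fintype (x := p.2)
    have h1 := monoAct_count_aux p.1 p.2
    rw [hz, hF] at h1
    have hq2 : (0 : ℚ) < (q : ℚ) - 1 := by
      have : (1 : ℚ) < q := by exact_mod_cast hq1
      linarith
    have hch : (0 : ℚ) < n.choose W := by exact_mod_cast Nat.choose_pos hWn
    rw [le_div_iff₀ (by positivity)]
    have h2 : (((T p.1 p.2).card * ((q - 1) ^ W * n.choose W) : ℕ) : ℚ) ≤ Fintype.card G := by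
      exact_mod_cast h1
    push_cast [Nat.cast_sub hq1.le] at h2
    exact h2
  have hB : (B.card : ℚ) < Fintype.card G := by
    calc (B.card : ℚ) ≤ ∑ W ∈ Finset.Icc 1 d, ∑ p ∈ S W ×ˢ S W, ((T p.1 p.2).card : ℚ) := by
          have : B.card ≤ ∑ W ∈ Finset.Icc 1 d, ∑ p ∈ S W ×ˢ S W, (T p.1 p.2).card :=
            Finset.card_biUnion_le.trans (Finset.sum_le_sum fun W _ => Finset.card_biUnion_le)
          exact_mod_cast this
      _ ≤ ∑ W ∈ Finset.Icc 1 d, (Fintype.card G : ℚ) *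
            ((A W : ℚ) ^ 2 / (((q : ℚ) - 1) ^ W * (n.choose W : ℚ))) := by
          refine Finset.sum_le_sum fun W _ => ?_
          refine (Finset.sum_le_sum (hT W)).trans (le_of_eq ?_)
          rw [Finset.sum_const, Finset.card_product, hS, nsmul_eq_mul]
          push_cast
          ring
      _ < Fintype.card G := by
          rw [← Finset.mul_sum]
          exact mul_lt_of_lt_one_right hG h
  have hB' : B.card < Fintype.card G := by exact_mod_cast hB
  obtain ⟨g, hg⟩ : ∃ g, g ∉ B := by
    by_contra hcon
    push Not at hcon
    rw [Finset.eq_univ_iff_forall.2 hcon, Finset.card_univ] at hB'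
    exact lt_irrefl _ hB'
  refine ⟨1, g.1, fun _ => 1, fun j => (g.2 j : F), fun _ => one_ne_zero,
    fun j => (g.2 j).ne_zero, ?_⟩
  intro x hx1 hx2 hx0
  by_contra hlt
  apply hg
  have hx1 : x ∈ Cb := by simpa using hx1
  refine Finset.mem_biUnion.2 ⟨hammingNorm x, Finset.mem_Icc.2
    ⟨hammingNorm_pos_iff.2 hx0, not_lt.1 hlt⟩, Finset.mem_biUnion.2 ⟨(x, monoAct g x), ?_, ?_⟩⟩
  · refine Finset.mem_product.2 ⟨?_, ?_⟩
    · exact Finset.mem_filter.2 ⟨Finset.mem_univ _, hx1, rfl⟩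
    · exact Finset.mem_filter.2 ⟨Finset.mem_univ _, hx2, monoAct_norm g x⟩
  · exact Finset.mem_filter.2 ⟨Finset.mem_univ _, rfl⟩
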